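/- arXiv:2511.12198 — 3 statements merged into one kernel-verified Lean document; each statement's English description precedes it below -/
import Mathlib

section
/- Let Λ be a finite-dimensional algebra over a field K and let S be a semibrick in mod Λ. Then MCE(T(S)^⊥) = S and ME(^⊥F(S)) = S, i.e., S coincides with the set of minimal co-extending modules of the torsion-free class T(S)^⊥ and with the set of minimal extending modules of the torsion class ^⊥F(S). -/
open Function DirectSum

namespace BrickPaper

variable (Λ : Type) [Ring Λ]

/-- `M` belongs to `mod Λ`, i.e. is a finitely generated module. -/
abbrev FG (M : ModuleCat.{0} Λ) : Prop := Module.Finite Λ M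

/-- A class of modules closed under isomorphism. -/
def IsoClosed (C : Set (ModuleCat.{0} Λ)) : Prop :=
  ∀ ⦃M N : ModuleCat.{0} Λ⦄, Nonempty (M ≃ₗ[Λ] N) → M ∈ C → N ∈ C

/-- A class of modules containing the zero modules. -/
def HasZeroObj (C : Set (ModuleCat.{0} Λ)) : Prop :=
  ∀ M : ModuleCat.{0} Λ, Subsingleton M → M ∈ C

/-- Closure under extensions: if `0 → A → M → B → 0` is exact with `A, B ∈ C` then `M ∈ C`. -/
def ExtClosed (C : Set (ModuleCat.{0} Λ)) : Prop :=
  ∀ ⦃A M B : ModuleCat.{0} Λ⦄ (f : A →ₗ[Λ] M) (g : M →ₗ[Λ] B),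
    Function.Injective f → Function.Surjective g →
    LinearMap.range f = LinearMap.ker g → A ∈ C → B ∈ C → M ∈ C

/-- Closure under quotients (images of surjections). -/
def QuotClosed (C : Set (ModuleCat.{0} Λ)) : Prop :=
  ∀ ⦃M N : ModuleCat.{0} Λ⦄ (g : M →ₗ[Λ] N), Function.Surjective g → M ∈ C → N ∈ C

/-- Closure under submodules (sources of injections). -/
def SubClosed (C : Set (ModuleCat.{0} Λ)) : Prop :=
  ∀ ⦃M N : ModuleCat.{0} Λ⦄ (f : M →ₗ[Λ] N), Function.Injective f → N ∈ C → M ∈ C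

/-- Closure under kernels of morphisms between members. -/
def KerClosed (C : Set (ModuleCat.{0} Λ)) : Prop :=
  ∀ ⦃M N : ModuleCat.{0} Λ⦄ (f : M →ₗ[Λ] N), M ∈ C → N ∈ C →
    ModuleCat.of Λ ↥(LinearMap.ker f) ∈ C

/-- Closure under cokernels of morphisms between members. -/
def CokerClosed (C : Set (ModuleCat.{0} Λ)) : Prop :=
  ∀ ⦃M N : ModuleCat.{0} Λ⦄ (f : M →ₗ[Λ] N), M ∈ C → N ∈ C →
    ModuleCat.of Λ ((N : Type) ⧸ LinearMap.range f) ∈ C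

/-- A wide subcategory of `mod Λ`: a class of finitely generated modules, closed under
isomorphisms, containing `0`, and closed under kernels, cokernels and extensions. -/
def IsWide (C : Set (ModuleCat.{0} Λ)) : Prop :=
  (∀ M ∈ C, FG Λ M) ∧ IsoClosed Λ C ∧ HasZeroObj Λ C ∧
    KerClosed Λ C ∧ CokerClosed Λ C ∧ ExtClosed Λ C

/-- A wide subcategory of the big module category `Mod Λ` (no finiteness condition). -/
def IsWideBig (C : Set (ModuleCat.{0} Λ)) : Prop :=
  IsoClosed Λ C ∧ HasZeroObj Λ C ∧ KerClosed Λ C ∧ CokerClosed Λ C ∧ ExtClosed Λ C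

/-- A torsion class in `mod Λ`: closed under quotients and extensions. -/
def IsTorsionClass (C : Set (ModuleCat.{0} Λ)) : Prop :=
  (∀ M ∈ C, FG Λ M) ∧ IsoClosed Λ C ∧ HasZeroObj Λ C ∧ QuotClosed Λ C ∧ ExtClosed Λ C

/-- A torsion-free class in `mod Λ`: closed under submodules and extensions. -/
def IsTorsionFreeClass (C : Set (ModuleCat.{0} Λ)) : Prop :=
  (∀ M ∈ C, FG Λ M) ∧ IsoClosed Λ C ∧ HasZeroObj Λ C ∧ SubClosed Λ C ∧ ExtClosed Λ C

/-- The smallest torsion class containing `X`. -/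
def torsClosure (X : Set (ModuleCat.{0} Λ)) : Set (ModuleCat.{0} Λ) :=
  ⋂₀ {C | IsTorsionClass Λ C ∧ X ⊆ C}

/-- The smallest torsion-free class containing `X`. -/
def torfClosure (X : Set (ModuleCat.{0} Λ)) : Set (ModuleCat.{0} Λ) :=
  ⋂₀ {C | IsTorsionFreeClass Λ C ∧ X ⊆ C}

/-- A widely generated torsion class. -/
def IsWidelyGenTors (T : Set (ModuleCat.{0} Λ)) : Prop :=
  IsTorsionClass Λ T ∧ ∃ W, IsWide Λ W ∧ T = torsClosure Λ W

/-- A widely generated torsion-free class. -/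
def IsWidelyGenTorf (F : Set (ModuleCat.{0} Λ)) : Prop :=
  IsTorsionFreeClass Λ F ∧ ∃ W, IsWide Λ W ∧ F = torfClosure Λ W

/-- A finitely generated torsion class: generated by a single module of `mod Λ`. -/
def IsFinGenTors (T : Set (ModuleCat.{0} Λ)) : Prop :=
  IsTorsionClass Λ T ∧ ∃ M : ModuleCat.{0} Λ, FG Λ M ∧ T = torsClosure Λ {M}

/-- `T' ` covers `T` in the poset of torsion classes. -/
def TorsCovers (T' T : Set (ModuleCat.{0} Λ)) : Prop :=
  IsTorsionClass Λ T' ∧ T ⊂ T' ∧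
    ∀ T'', IsTorsionClass Λ T'' → T ⊂ T'' → T'' ⊆ T' → T'' = T'

/-- `F'` covers `F` in the poset of torsion-free classes. -/
def TorfCovers (F' F : Set (ModuleCat.{0} Λ)) : Prop :=
  IsTorsionFreeClass Λ F' ∧ F ⊂ F' ∧
    ∀ F'', IsTorsionFreeClass Λ F'' → F ⊂ F'' → F'' ⊆ F' → F'' = F'

/-- A brick: a finitely generated module whose endomorphism ring is a division ring. -/
def IsBrick (M : ModuleCat.{0} Λ) : Prop :=
  FG Λ M ∧ Nontrivial M ∧ ∀ f : M →ₗ[Λ] M, f ≠ 0 → Function.Bijective f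

/-- A semibrick, regarded as an isomorphism-closed class of bricks (i.e. a set of
isomorphism classes of bricks) which are pairwise Hom-orthogonal. -/
def IsSemibrick (S : Set (ModuleCat.{0} Λ)) : Prop :=
  (∀ M ∈ S, IsBrick Λ M) ∧ IsoClosed Λ S ∧
    ∀ M ∈ S, ∀ N ∈ S, IsEmpty (M ≃ₗ[Λ] N) → ∀ f : M →ₗ[Λ] N, f = 0

/-- A monobrick, regarded as an isomorphism-closed class of bricks (i.e. a set of
isomorphism classes of bricks) such that every morphism between members is zero or injective. -/
def IsMonobrick (S : Set (ModuleCat.{0} Λ)) : Prop :=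
  (∀ M ∈ S, IsBrick Λ M) ∧ IsoClosed Λ S ∧
    ∀ M ∈ S, ∀ N ∈ S, ∀ f : M →ₗ[Λ] N, f = 0 ∨ Function.Injective f

/-- `N` is a cofinal extension of the monobrick `M`. -/
def IsCofinalExtension (M N : Set (ModuleCat.{0} Λ)) : Prop :=
  IsMonobrick Λ N ∧ M ⊆ N ∧
    ∀ X ∈ N, ∃ Y ∈ M, ∃ f : X →ₗ[Λ] Y, Function.Injective f

/-- A cofinally closed monobrick: a monobrick with no proper cofinal extension. -/
def IsCofinallyClosed (M : Set (ModuleCat.{0} Λ)) : Prop :=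
  IsMonobrick Λ M ∧ ∀ N, IsCofinalExtension Λ M N → N = M

/-- `S` contains only finitely many modules up to isomorphism. -/
def FiniteUpToIso (S : Set (ModuleCat.{0} Λ)) : Prop :=
  ∃ B : Set (ModuleCat.{0} Λ), B.Finite ∧ ∀ M ∈ S, ∃ N ∈ B, Nonempty (M ≃ₗ[Λ] N)

/-- `Λ` is brick-finite: there are only finitely many bricks up to isomorphism. -/
def BrickFinite : Prop := FiniteUpToIso Λ {M | IsBrick Λ M}

/-- Right Hom-perpendicular class `T^⊥` inside `mod Λ`. -/
def rPerp (T : Set (ModuleCat.{0} Λ)) : Set (ModuleCat.{0} Λ) :=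
  {M | FG Λ M ∧ ∀ X ∈ T, ∀ f : X →ₗ[Λ] M, f = 0}

/-- Left Hom-perpendicular class `^⊥F` inside `mod Λ`. -/
def lPerp (F : Set (ModuleCat.{0} Λ)) : Set (ModuleCat.{0} Λ) :=
  {M | FG Λ M ∧ ∀ Y ∈ F, ∀ f : M →ₗ[Λ] Y, f = 0}

/-- A minimal extending module for a torsion class `T`. -/
def IsMinExt (T : Set (ModuleCat.{0} Λ)) (M : ModuleCat.{0} Λ) : Prop :=
  FG Λ M ∧ Nontrivial M ∧
    (∀ S : Submodule Λ M, S ≠ ⊥ → ModuleCat.of Λ ((M : Type) ⧸ S) ∈ T) ∧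
    (∀ (X T' : ModuleCat.{0} Λ) (f : M →ₗ[Λ] X) (g : X →ₗ[Λ] T'),
      Function.Injective f → Function.Surjective g →
      LinearMap.range f = LinearMap.ker g → T' ∈ T →
      (¬ ∃ r : X →ₗ[Λ] M, r ∘ₗ f = LinearMap.id) → X ∈ T) ∧
    (∀ X ∈ T, ∀ f : X →ₗ[Λ] M, f = 0)

/-- A minimal co-extending module for a torsion-free class `F`. -/
def IsMinCoext (F : Set (ModuleCat.{0} Λ)) (M : ModuleCat.{0} Λ) : Prop :=
  FG Λ M ∧ Nontrivial M ∧
    (∀ S : Submodule Λ M, S ≠ ⊤ → ModuleCat.of Λ ↥S ∈ F) ∧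
    (∀ (X F' : ModuleCat.{0} Λ) (f : F' →ₗ[Λ] X) (g : X →ₗ[Λ] M),
      Function.Injective f → Function.Surjective g →
      LinearMap.range f = LinearMap.ker g → F' ∈ F →
      (¬ ∃ s : M →ₗ[Λ] X, g ∘ₗ s = LinearMap.id) → X ∈ F) ∧
    (∀ Y ∈ F, ∀ f : M →ₗ[Λ] Y, f = 0)

/-- The set (of representatives of isomorphism classes) of minimal extending modules. -/
def ME (T : Set (ModuleCat.{0} Λ)) : Set (ModuleCat.{0} Λ) := {M | IsMinExt Λ T M}

/-- The set (of representatives of isomorphism classes) of minimal co-extending modules. -/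
def MCE (F : Set (ModuleCat.{0} Λ)) : Set (ModuleCat.{0} Λ) := {M | IsMinCoext Λ F M}

/-- `M` admits a finite filtration with subquotients isomorphic to members of `B`. -/
def FiltMem (B : Set (ModuleCat.{0} Λ)) (M : ModuleCat.{0} Λ) : Prop :=
  ∃ (n : ℕ) (c : Fin (n + 1) → Submodule Λ M), Monotone c ∧ c 0 = ⊥ ∧ c (Fin.last n) = ⊤ ∧
    ∀ i : Fin n, ∃ N ∈ B,
      Nonempty ((↥(c i.succ) ⧸ Submodule.comap (c i.succ).subtype (c i.castSucc)) ≃ₗ[Λ] N)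

/-- `Filt B`. -/
def filtClosure (B : Set (ModuleCat.{0} Λ)) : Set (ModuleCat.{0} Λ) :=
  {M | FiltMem Λ B M}

/-- The simple objects of a subcategory `C`, i.e. nonzero members with no proper nonzero
subobject belonging to `C`. -/
def simOf (C : Set (ModuleCat.{0} Λ)) : Set (ModuleCat.{0} Λ) :=
  {M | M ∈ C ∧ Nontrivial M ∧
    ∀ (X : ModuleCat.{0} Λ) (f : X →ₗ[Λ] M), X ∈ C → Function.Injective f →
      LinearMap.range f = ⊥ ∨ LinearMap.range f = ⊤}

/-- The subcategory `α(T) = {X ∈ T : for all g : Y → X with Y ∈ T, ker g ∈ T}`. -/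
def alphaOf (T : Set (ModuleCat.{0} Λ)) : Set (ModuleCat.{0} Λ) :=
  {X | X ∈ T ∧ ∀ (Y : ModuleCat.{0} Λ) (g : Y →ₗ[Λ] X), Y ∈ T →
    ModuleCat.of Λ ↥(LinearMap.ker g) ∈ T}

/-- Covariantly finite subcategory of `mod Λ`. -/
def CovariantlyFinite (B : Set (ModuleCat.{0} Λ)) : Prop :=
  ∀ M : ModuleCat.{0} Λ, FG Λ M → ∃ N ∈ B, ∃ f : M →ₗ[Λ] N,
    ∀ N' ∈ B, ∀ g : M →ₗ[Λ] N', ∃ h : N →ₗ[Λ] N', h ∘ₗ f = g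

/-- Contravariantly finite subcategory of `mod Λ`. -/
def ContravariantlyFinite (B : Set (ModuleCat.{0} Λ)) : Prop :=
  ∀ M : ModuleCat.{0} Λ, FG Λ M → ∃ N ∈ B, ∃ f : N →ₗ[Λ] M,
    ∀ N' ∈ B, ∀ g : N' →ₗ[Λ] M, ∃ h : N' →ₗ[Λ] N, f ∘ₗ h = g

/-- Functorially finite subcategory of `mod Λ`. -/
def FunctoriallyFinite (B : Set (ModuleCat.{0} Λ)) : Prop :=
  CovariantlyFinite Λ B ∧ ContravariantlyFinite Λ B

/-- Closure under (set-indexed) coproducts. -/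
def CoprodClosed (C : Set (ModuleCat.{0} Λ)) : Prop :=
  ∀ (ι : Type) (M : ι → ModuleCat.{0} Λ), (∀ i, M i ∈ C) →
    ModuleCat.of Λ (⨁ i, (M i : Type)) ∈ C

/-- Closure under (set-indexed) products. -/
def ProdClosed (C : Set (ModuleCat.{0} Λ)) : Prop :=
  ∀ (ι : Type) (M : ι → ModuleCat.{0} Λ), (∀ i, M i ∈ C) →
    ModuleCat.of Λ ((i : ι) → (M i : Type)) ∈ C

/-! Lattice-theoretic notions in the complete lattice of torsion classes. -/

/-- The join of a set of torsion classes. -/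
def torsJoin (X : Set (Set (ModuleCat.{0} Λ))) : Set (ModuleCat.{0} Λ) :=
  torsClosure Λ (⋃₀ X)

/-- The meet of a set of torsion classes (inside the lattice of torsion classes,
whose top element is `mod Λ`). -/
def torsMeet (X : Set (Set (ModuleCat.{0} Λ))) : Set (ModuleCat.{0} Λ) :=
  {M | FG Λ M} ∩ ⋂₀ X

/-- A completely join-irreducible torsion class. -/
def CompletelyJoinIrred (J : Set (ModuleCat.{0} Λ)) : Prop :=
  IsTorsionClass Λ J ∧
    ∀ X : Set (Set (ModuleCat.{0} Λ)), (∀ a ∈ X, IsTorsionClass Λ a) →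
      torsJoin Λ X = J → J ∈ X

/-- `J_* = ⋁ {x : x < J}`. -/
def jstar (J : Set (ModuleCat.{0} Λ)) : Set (ModuleCat.{0} Λ) :=
  torsJoin Λ {C | IsTorsionClass Λ C ∧ C ⊂ J}

/-- `k = κ(J) = max {x : J ∧ x = J_*}`. -/
def IsKappa (J k : Set (ModuleCat.{0} Λ)) : Prop :=
  IsTorsionClass Λ k ∧ J ∩ k = jstar Λ J ∧
    ∀ C, IsTorsionClass Λ C → J ∩ C = jstar Λ J → C ⊆ k

/-- `A` is a join representation of the torsion class `T`. -/
def IsJoinRep (T : Set (ModuleCat.{0} Λ)) (A : Set (Set (ModuleCat.{0} Λ))) : Prop :=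
  (∀ a ∈ A, IsTorsionClass Λ a) ∧ torsJoin Λ A = T

/-- `A` refines `B`. -/
def Refines (A B : Set (Set (ModuleCat.{0} Λ))) : Prop :=
  ∀ a ∈ A, ∃ b ∈ B, a ⊆ b

/-- `A` is the canonical join representation of `T`. -/
def IsCJR (T : Set (ModuleCat.{0} Λ)) (A : Set (Set (ModuleCat.{0} Λ))) : Prop :=
  IsJoinRep Λ T A ∧ (∀ B, IsJoinRep Λ T B → Refines Λ A B) ∧
    ∀ a ∈ A, ∀ b ∈ A, a ⊆ b → a = b

/-- `Kb = κ̄(T) = ⋀ {κ(j) : j ∈ CJR(T)}`, the extended kappa map. -/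
def IsKappaBar (T Kb : Set (ModuleCat.{0} Λ)) : Prop :=
  ∃ A, IsCJR Λ T A ∧ (∀ j ∈ A, CompletelyJoinIrred Λ j) ∧
    (∀ j ∈ A, ∃ k, IsKappa Λ j k) ∧
    Kb = torsMeet Λ {k | ∃ j ∈ A, IsKappa Λ j k}

/-- The kappa order: `a ≤_κ b` iff `a ≤ b` and `κ̄(a) ≥ κ̄(b)`. -/
def KappaLE (a b : Set (ModuleCat.{0} Λ)) : Prop :=
  a ⊆ b ∧ ∀ Ka Kb, IsKappaBar Λ a Ka → IsKappaBar Λ b Kb → Kb ⊆ Ka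

section

variable {Λ}

section Exact

variable {A M B N : Type} [AddCommGroup A] [AddCommGroup M] [AddCommGroup B] [AddCommGroup N]
  [Module Λ A] [Module Λ M] [Module Λ B] [Module Λ N] {f : A →ₗ[Λ] M} {g : M →ₗ[Λ] B}

/-- A map into the middle term of a left exact sequence vanishes if its composite with the
second map does and there are no nonzero maps into the first term. -/
lemma eq_zero_of_comp_eq_zero (hf : Function.Injective f)
    (hfg : LinearMap.range f = LinearMap.ker g) (h0 : ∀ k : N →ₗ[Λ] A, k = 0)
    (h : N →ₗ[Λ] M) (hgh : g ∘ₗ h = 0) : h = 0 := by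
  have hr : ∀ x, h x ∈ LinearMap.range f := fun x => by
    rw [hfg]
    exact LinearMap.congr_fun hgh x
  have key := h0 ((LinearEquiv.ofInjective f hf).symm.toLinearMap ∘ₗ
    h.codRestrict (LinearMap.range f) hr)
  ext x
  have hx : (LinearEquiv.ofInjective f hf).symm ⟨h x, hr x⟩ = 0 := LinearMap.congr_fun key x
  rw [LinearEquiv.symm_apply_eq, map_zero] at hx
  exact congrArg Subtype.val hx

/-- A map out of the middle term of a right exact sequence vanishes if its composite with the
first map does and there are no nonzero maps out of the third term. -/
lemma eq_zero_of_precomp_eq_zero (hg : Function.Surjective g)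
    (hfg : LinearMap.range f = LinearMap.ker g) (h0 : ∀ k : B →ₗ[Λ] N, k = 0)
    (h : M →ₗ[Λ] N) (hhf : h ∘ₗ f = 0) : h = 0 := by
  have hker : LinearMap.ker g ≤ LinearMap.ker h := by
    rwa [← hfg, LinearMap.range_le_ker_iff]
  have key := h0 ((LinearMap.ker g).liftQ h hker ∘ₗ
    (g.quotKerEquivOfSurjective hg).symm.toLinearMap)
  ext x
  have hx := LinearMap.congr_fun key (g x)
  rw [LinearMap.comp_apply, LinearEquiv.coe_coe,
    show (g.quotKerEquivOfSurjective hg).symm (g x) = Submodule.Quotient.mk x from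
      (LinearEquiv.symm_apply_eq _).2 rfl] at hx
  exact hx

/-- An extension of finitely generated modules over a Noetherian ring is finitely generated. -/
lemma finite_of_range_eq_ker [IsNoetherianRing Λ] [Module.Finite Λ A] [Module.Finite Λ B]
    (hfg : LinearMap.range f = LinearMap.ker g) : Module.Finite Λ M := by
  have := isNoetherian_of_range_eq_ker f g hfg
  infer_instance

end Exact

/-- Finitely generated modules without nonzero maps to a fixed module form a torsion class. -/
lemma isTorsionClass_hom_zero [IsNoetherianRing Λ] (M : ModuleCat.{0} Λ) :
    IsTorsionClass Λ {X | FG Λ X ∧ ∀ f : X →ₗ[Λ] M, f = 0} := by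
  refine ⟨fun X hX => hX.1, ?_, ?_, ?_, ?_⟩
  · rintro X Y ⟨e⟩ ⟨hX, h⟩
    have : Module.Finite Λ X := hX
    refine ⟨Module.Finite.equiv e, fun f => ?_⟩
    ext y
    simpa using LinearMap.congr_fun (h (f ∘ₗ e.toLinearMap)) (e.symm y)
  · intro X hX
    exact ⟨inferInstanceAs (Module.Finite Λ X), fun f => Subsingleton.elim _ _⟩
  · rintro X Y g hg ⟨hX, h⟩
    have : Module.Finite Λ X := hX
    refine ⟨Module.Finite.of_surjective g hg, fun f => ?_⟩
    ext y
    obtain ⟨x, rfl⟩ := hg y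
    exact LinearMap.congr_fun (h (f ∘ₗ g)) x
  · rintro A X B f g _ hg hfg ⟨hA, hA0⟩ ⟨hB, hB0⟩
    have : Module.Finite Λ A := hA
    have : Module.Finite Λ B := hB
    refine ⟨finite_of_range_eq_ker hfg, fun h => ?_⟩
    exact eq_zero_of_precomp_eq_zero hg hfg hB0 h (hA0 _)

/-- Finitely generated modules without nonzero maps from a fixed module form a
torsion-free class. -/
lemma isTorsionFreeClass_hom_zero [IsNoetherianRing Λ] (M : ModuleCat.{0} Λ) :
    IsTorsionFreeClass Λ {Y | FG Λ Y ∧ ∀ f : M →ₗ[Λ] Y, f = 0} := by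
  refine ⟨fun X hX => hX.1, ?_, ?_, ?_, ?_⟩
  · rintro X Y ⟨e⟩ ⟨hX, h⟩
    have : Module.Finite Λ X := hX
    refine ⟨Module.Finite.equiv e, fun f => ?_⟩
    ext y
    apply e.symm.injective
    simpa using LinearMap.congr_fun (h (e.symm.toLinearMap ∘ₗ f)) y
  · intro X hX
    exact ⟨inferInstanceAs (Module.Finite Λ X), fun f => Subsingleton.elim _ _⟩
  · rintro X Y g hg ⟨hY, h⟩
    have : Module.Finite Λ Y := hY
    refine ⟨Module.Finite.of_injective g hg, fun f => ?_⟩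
    ext y
    apply hg
    simpa using LinearMap.congr_fun (h (g ∘ₗ f)) y
  · rintro A X B f g hf _ hfg ⟨hA, hA0⟩ ⟨hB, hB0⟩
    have : Module.Finite Λ A := hA
    have : Module.Finite Λ B := hB
    refine ⟨finite_of_range_eq_ker hfg, fun h => ?_⟩
    exact eq_zero_of_comp_eq_zero hf hfg hA0 h (hB0 _)

lemma rPerp_torsClosure [IsNoetherianRing Λ] {S : Set (ModuleCat.{0} Λ)}
    (hS : ∀ M ∈ S, FG Λ M) : rPerp Λ (torsClosure Λ S) = rPerp Λ S := by
  ext M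
  refine ⟨fun h => ⟨h.1, fun X hX => h.2 X fun C hC => hC.2 hX⟩,
    fun h => ⟨h.1, fun X hX => ?_⟩⟩
  exact (hX _ ⟨isTorsionClass_hom_zero M, fun Y hY => ⟨hS Y hY, h.2 Y hY⟩⟩).2

lemma lPerp_torfClosure [IsNoetherianRing Λ] {S : Set (ModuleCat.{0} Λ)}
    (hS : ∀ M ∈ S, FG Λ M) : lPerp Λ (torfClosure Λ S) = lPerp Λ S := by
  ext M
  refine ⟨fun h => ⟨h.1, fun X hX => h.2 X fun C hC => hC.2 hX⟩,
    fun h => ⟨h.1, fun X hX => ?_⟩⟩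
  exact (hX _ ⟨isTorsionFreeClass_hom_zero M, fun Y hY => ⟨hS Y hY, h.2 Y hY⟩⟩).2

namespace IsSemibrick

variable {S : Set (ModuleCat.{0} Λ)}

lemma bijective (hS : IsSemibrick Λ S) {M N : ModuleCat.{0} Λ} (hM : M ∈ S) (hN : N ∈ S)
    {f : M →ₗ[Λ] N} (hf : f ≠ 0) : Function.Bijective f := by
  by_cases h : IsEmpty (M ≃ₗ[Λ] N)
  · exact absurd (hS.2.2 M hM N hN h f) hf
  · obtain ⟨e⟩ := not_isEmpty_iff.1 h
    have hb : Function.Bijective (e.symm.toLinearMap ∘ₗ f) := by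
      refine (hS.1 M hM).2.2 _ fun h0 => hf ?_
      ext x
      apply e.symm.injective
      simpa using LinearMap.congr_fun h0 x
    have hfe : (f : M → N) = e ∘ (e.symm.toLinearMap ∘ₗ f) := by
      ext x
      simp
    rw [hfe]
    exact e.bijective.comp hb

lemma of_submodule_mem_rPerp [IsNoetherianRing Λ] (hS : IsSemibrick Λ S)
    {M : ModuleCat.{0} Λ} (hM : M ∈ S) {N : Submodule Λ M} (hN : N ≠ ⊤) :
    ModuleCat.of Λ N ∈ rPerp Λ S := by
  have : Module.Finite Λ M := (hS.1 M hM).1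
  refine ⟨inferInstanceAs (Module.Finite Λ N), fun X hX (f : X →ₗ[Λ] N) => ?_⟩
  by_contra hf
  have h0 : N.subtype ∘ₗ f ≠ 0 := fun h => hf <| by
    ext x
    simpa using LinearMap.congr_fun h x
  refine hN (eq_top_iff.2 fun m _ => ?_)
  obtain ⟨x, rfl⟩ := (hS.bijective hX hM h0).2 m
  exact (f x).2

lemma of_quotient_mem_lPerp (hS : IsSemibrick Λ S)
    {M : ModuleCat.{0} Λ} (hM : M ∈ S) {N : Submodule Λ M} (hN : N ≠ ⊥) :
    ModuleCat.of Λ (M ⧸ N) ∈ lPerp Λ S := by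
  have : Module.Finite Λ M := (hS.1 M hM).1
  refine ⟨inferInstanceAs (Module.Finite Λ (M ⧸ N)), fun X hX (f : (M ⧸ N) →ₗ[Λ] X) => ?_⟩
  by_contra hf
  have h0 : f ∘ₗ N.mkQ ≠ 0 := fun h => hf <| by
    ext x
    simpa using LinearMap.congr_fun h x
  refine hN (eq_bot_iff.2 fun m hm => ?_)
  refine (hS.bijective hM hX h0).1 ?_
  simp [(Submodule.Quotient.mk_eq_zero N).2 hm]

lemma isMinCoext [IsNoetherianRing Λ] (hS : IsSemibrick Λ S) {M : ModuleCat.{0} Λ}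
    (hM : M ∈ S) : IsMinCoext Λ (rPerp Λ S) M := by
  refine ⟨(hS.1 M hM).1, (hS.1 M hM).2.1, fun N hN => hS.of_submodule_mem_rPerp hM hN, ?_,
    fun Y hY => hY.2 M hM⟩
  intro X F' f g hf _ hfg hF' hns
  have : Module.Finite Λ F' := hF'.1
  have : Module.Finite Λ M := (hS.1 M hM).1
  refine ⟨finite_of_range_eq_ker hfg, fun Y hY h => ?_⟩
  by_contra hh
  have h0 : g ∘ₗ h ≠ 0 := fun h0 =>
    hh (eq_zero_of_comp_eq_zero hf hfg (hF'.2 Y hY) h h0)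
  refine hns ⟨h ∘ₗ (LinearEquiv.ofBijective _ (hS.bijective hY hM h0)).symm.toLinearMap, ?_⟩
  ext m
  exact (LinearEquiv.ofBijective _ (hS.bijective hY hM h0)).apply_symm_apply m

lemma isMinExt [IsNoetherianRing Λ] (hS : IsSemibrick Λ S) {M : ModuleCat.{0} Λ}
    (hM : M ∈ S) : IsMinExt Λ (lPerp Λ S) M := by
  refine ⟨(hS.1 M hM).1, (hS.1 M hM).2.1, fun N hN => hS.of_quotient_mem_lPerp hM hN, ?_,
    fun Y hY => hY.2 M hM⟩
  intro X T' f g _ hg hfg hT' hns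
  have : Module.Finite Λ T' := hT'.1
  have : Module.Finite Λ M := (hS.1 M hM).1
  refine ⟨finite_of_range_eq_ker hfg, fun Y hY h => ?_⟩
  by_contra hh
  have h0 : h ∘ₗ f ≠ 0 := fun h0 =>
    hh (eq_zero_of_precomp_eq_zero hg hfg (hT'.2 Y hY) h h0)
  refine hns ⟨(LinearEquiv.ofBijective _ (hS.bijective hM hY h0)).symm.toLinearMap ∘ₗ h, ?_⟩
  ext m
  exact (LinearEquiv.ofBijective _ (hS.bijective hM hY h0)).symm_apply_apply m

lemma mem_of_isMinCoext [IsNoetherianRing Λ] (hS : IsSemibrick Λ S) {M : ModuleCat.{0} Λ}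
    (hM : IsMinCoext Λ (rPerp Λ S) M) : M ∈ S := by
  obtain ⟨hfin, hnt, hsub, hext, hhom⟩ := hM
  have hMF : M ∉ rPerp Λ S := fun h => by
    obtain ⟨m, hm⟩ := exists_ne (0 : M)
    exact hm (LinearMap.congr_fun (hhom M h LinearMap.id) m)
  obtain ⟨X, hX, f, hf⟩ : ∃ X ∈ S, ∃ f : X →ₗ[Λ] M, f ≠ 0 := by
    by_contra! h
    exact hMF ⟨hfin, h⟩
  have hsurj : Function.Surjective f := by
    by_contra h
    have h0 := (hsub (LinearMap.range f) (mt LinearMap.range_eq_top.1 h)).2 X hX f.rangeRestrict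
    refine hf ?_
    ext x
    exact congrArg Subtype.val (LinearMap.congr_fun h0 x)
  obtain ⟨s, hs⟩ : ∃ s : M →ₗ[Λ] X, f ∘ₗ s = LinearMap.id := by
    by_contra h
    have hXF : X ∈ rPerp Λ S := hext X (ModuleCat.of Λ (LinearMap.ker f))
      (LinearMap.ker f).subtype f Subtype.val_injective hsurj (Submodule.range_subtype _)
      (hS.of_submodule_mem_rPerp hX (mt LinearMap.ker_eq_top.1 hf)) h
    have := (hS.1 X hX).2.1
    obtain ⟨x, hx⟩ := exists_ne (0 : X)
    exact hx (LinearMap.congr_fun (hXF.2 X hX LinearMap.id) x)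
  have hsf : s ∘ₗ f ≠ 0 := fun h => hf <| by
    rw [← LinearMap.id_comp f, ← hs, LinearMap.comp_assoc, h, LinearMap.comp_zero]
  have hinj : Function.Injective f := Function.Injective.of_comp (hS.bijective hX hX hsf).1
  exact hS.2.1 ⟨LinearEquiv.ofBijective f ⟨hinj, hsurj⟩⟩ hX

lemma mem_of_isMinExt (hS : IsSemibrick Λ S) {M : ModuleCat.{0} Λ}
    (hM : IsMinExt Λ (lPerp Λ S) M) : M ∈ S := by
  obtain ⟨hfin, hnt, hquot, hext, hhom⟩ := hM
  have hMT : M ∉ lPerp Λ S := fun h => by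
    obtain ⟨m, hm⟩ := exists_ne (0 : M)
    exact hm (LinearMap.congr_fun (hhom M h LinearMap.id) m)
  obtain ⟨X, hX, f, hf⟩ : ∃ X ∈ S, ∃ f : M →ₗ[Λ] X, f ≠ 0 := by
    by_contra! h
    exact hMT ⟨hfin, h⟩
  have hinj : Function.Injective f := by
    by_contra h
    have h0 := (hquot (LinearMap.ker f) (mt LinearMap.ker_eq_bot.1 h)).2 X hX
      ((LinearMap.ker f).liftQ f le_rfl)
    refine hf ?_
    ext x
    exact LinearMap.congr_fun h0 (Submodule.Quotient.mk x)
  obtain ⟨r, hr⟩ : ∃ r : X →ₗ[Λ] M, r ∘ₗ f = LinearMap.id := by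
    by_contra h
    have hXT : X ∈ lPerp Λ S := hext X (ModuleCat.of Λ (X ⧸ LinearMap.range f))
      f (LinearMap.range f).mkQ hinj (Submodule.mkQ_surjective _) (Submodule.ker_mkQ _).symm
      (hS.of_quotient_mem_lPerp hX (mt LinearMap.range_eq_bot.1 hf)) h
    have := (hS.1 X hX).2.1
    obtain ⟨x, hx⟩ := exists_ne (0 : X)
    exact hx (LinearMap.congr_fun (hXT.2 X hX LinearMap.id) x)
  have hfr : f ∘ₗ r ≠ 0 := fun h => hf <| by
    rw [← LinearMap.comp_id f, ← hr, ← LinearMap.comp_assoc, h, LinearMap.zero_comp]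
  have hsurj : Function.Surjective f := Function.Surjective.of_comp (hS.bijective hX hX hfr).2
  exact hS.2.1 ⟨(LinearEquiv.ofBijective f ⟨hinj, hsurj⟩).symm⟩ hX

end IsSemibrick

end

/-- For a semibrick `S` in `mod Λ`, `MCE(T(S)^⊥) = S` and `ME(^⊥F(S)) = S`. -/
theorem MCE_torsClosure_perp_eq_self_and_ME_perp_torfClosure_eq_self
    (K Λ : Type) [Field K] [Ring Λ] [Algebra K Λ] [FiniteDimensional K Λ]
    (S : Set (ModuleCat.{0} Λ)) (hS : IsSemibrick Λ S) :
    MCE Λ (rPerp Λ (torsClosure Λ S)) = S ∧ ME Λ (lPerp Λ (torfClosure Λ S)) = S := by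
  have : IsNoetherianRing Λ := IsNoetherianRing.of_finite K Λ
  have hfg : ∀ M ∈ S, FG Λ M := fun M hM => (hS.1 M hM).1
  rw [rPerp_torsClosure hfg, lPerp_torfClosure hfg]
  exact ⟨Set.Subset.antisymm (fun _ => hS.mem_of_isMinCoext) fun _ => hS.isMinCoext,
    Set.Subset.antisymm (fun _ => hS.mem_of_isMinExt) fun _ => hS.isMinExt⟩

end BrickPaper
end

section
/- Let Λ be a finite-dimensional algebra over a field K. The assignments W ↦ sim(W) (the set of isomorphism classes of simple objects of W) and S ↦ Filt(S) are mutually inverse bijections between the set of wide subcategories of mod Λ and the set of semibricks in mod Λ. -/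
open Function DirectSum

namespace BrickPaper

variable (Λ : Type) [Ring Λ]

section LinearMaps

variable {R M N P : Type*} [Ring R] [AddCommGroup M] [Module R M] [AddCommGroup N] [Module R N]
  [AddCommGroup P] [Module R P]

/-- A linear map that kills the kernel of a surjection factors through it. -/
theorem exists_comp_eq_of_surjective (g : M →ₗ[R] N) (hg : Surjective g) (f : M →ₗ[R] P)
    (h : LinearMap.ker g ≤ LinearMap.ker f) : ∃ k : N →ₗ[R] P, ∀ m, k (g m) = f m := by
  refine ⟨(LinearMap.ker g).liftQ f h ∘ₗ (g.quotKerEquivOfSurjective hg).symm, fun m => ?_⟩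
  have : (g.quotKerEquivOfSurjective hg).symm (g m) = Submodule.Quotient.mk m := by
    rw [LinearEquiv.symm_apply_eq]
    rfl
  simp [this]

/-- A linear map whose range lies in the range of an injection factors through it. -/
theorem exists_comp_eq_of_injective (i : N →ₗ[R] P) (hi : Injective i) (f : M →ₗ[R] P)
    (h : LinearMap.range f ≤ LinearMap.range i) : ∃ k : M →ₗ[R] N, ∀ m, i (k m) = f m := by
  refine ⟨(LinearEquiv.ofInjective i hi).symm ∘ₗ
    f.codRestrict (LinearMap.range i) fun m => h ⟨m, rfl⟩, fun m => ?_⟩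
  have := (LinearEquiv.ofInjective i hi).apply_symm_apply
    (f.codRestrict (LinearMap.range i) (fun m => h ⟨m, rfl⟩) m)
  exact congrArg Subtype.val this

theorem nonempty_quotient_equiv (g : M →ₗ[R] N) (hg : Surjective g) (p : Submodule R M)
    (h : LinearMap.ker g = p) : Nonempty ((M ⧸ p) ≃ₗ[R] N) := by
  subst h
  exact ⟨g.quotKerEquivOfSurjective hg⟩

end LinearMaps

section Filtrations

variable {Λ}

/-- Modules built by finitely many successive extensions of zero modules by members of `B`,
each extension adding a new submodule from `B`. -/
inductive IteratedExt (B : Set (ModuleCat.{0} Λ)) : ModuleCat.{0} Λ → Prop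
  | zero (M : ModuleCat.{0} Λ) : Subsingleton M → IteratedExt B M
  | step {A M C : ModuleCat.{0} Λ} (f : A →ₗ[Λ] M) (g : M →ₗ[Λ] C) :
      Injective f → Surjective g → LinearMap.range f = LinearMap.ker g →
      A ∈ B → IteratedExt B C → IteratedExt B M

namespace IteratedExt

variable {B : Set (ModuleCat.{0} Λ)}

theorem congr {M N : ModuleCat.{0} Λ} (e : M ≃ₗ[Λ] N) (h : IteratedExt B M) :
    IteratedExt B N := by
  cases h with
  | zero _ h => exact zero _ e.symm.toEquiv.subsingleton
  | step f g hf hg hfg hA hC =>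
    refine step (e.toLinearMap ∘ₗ f) (g ∘ₗ e.symm.toLinearMap) (e.injective.comp hf)
      (hg.comp e.symm.surjective) ?_ hA hC
    ext x
    have := SetLike.ext_iff.1 hfg (e.symm x)
    simp only [LinearMap.mem_range, LinearMap.mem_ker, LinearMap.comp_apply,
      LinearEquiv.coe_coe] at this ⊢
    rw [← this]
    simp only [LinearEquiv.eq_symm_apply]

theorem of_mem {M : ModuleCat.{0} Λ} (h : M ∈ B) : IteratedExt B M :=
  step (C := ModuleCat.of Λ PUnit) LinearMap.id 0 injective_id (fun _ => ⟨0, Subsingleton.elim _ _⟩)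
    (by simp) h (zero _ inferInstanceAs (Subsingleton PUnit))

theorem extClosed : ExtClosed Λ {M | IteratedExt B M} := by
  intro A M D f g hf hg hfg hA hD
  change IteratedExt B A at hA
  induction hA generalizing M with
  | zero A _ =>
    have hker : LinearMap.ker g = ⊥ := by
      rw [← hfg, LinearMap.range_eq_bot]
      exact LinearMap.ext fun x => by rw [Subsingleton.elim x 0]; simp
    exact congr (LinearEquiv.ofBijective g ⟨LinearMap.ker_eq_bot.1 hker, hg⟩).symm hD
  | @step T A C j p hj hp hjp hT _ ih =>
    have hgf : ∀ a, g (f a) = 0 := fun a => by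
      have : f a ∈ LinearMap.ker g := hfg ▸ ⟨a, rfl⟩
      exact this
    have hpj : ∀ t, p (j t) = 0 := fun t => by
      have : j t ∈ LinearMap.ker p := hjp ▸ ⟨t, rfl⟩
      exact this
    let Q := LinearMap.range (f ∘ₗ j)
    obtain ⟨f', hf'⟩ := exists_comp_eq_of_surjective p hp (Q.mkQ ∘ₗ f) (by
      rw [← hjp]
      rintro _ ⟨t, rfl⟩
      simp only [LinearMap.mem_ker, LinearMap.comp_apply, Submodule.mkQ_apply,
        Submodule.Quotient.mk_eq_zero]
      exact ⟨t, rfl⟩)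
    obtain ⟨g', hg'⟩ := exists_comp_eq_of_surjective Q.mkQ Q.mkQ_surjective g (by
      rw [Submodule.ker_mkQ]
      rintro _ ⟨t, rfl⟩
      exact hgf _)
    refine step (C := ModuleCat.of Λ (M ⧸ Q)) (f ∘ₗ j) Q.mkQ (hf.comp hj) Q.mkQ_surjective
      Q.ker_mkQ.symm hT (ih (M := ModuleCat.of Λ (M ⧸ Q)) f' g' ?_ ?_ ?_)
    · rw [injective_iff_map_eq_zero]
      intro c hc
      obtain ⟨a, rfl⟩ := hp c
      rw [hf'] at hc
      simp only [LinearMap.comp_apply, Submodule.mkQ_apply, Submodule.Quotient.mk_eq_zero] at hc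
      obtain ⟨t, ht⟩ := hc
      rw [← hf ht, hpj]
    · intro d
      obtain ⟨m, rfl⟩ := hg d
      exact ⟨Q.mkQ m, hg' m⟩
    · ext x
      obtain ⟨m, rfl⟩ := Q.mkQ_surjective x
      constructor
      · rintro ⟨c, hc⟩
        obtain ⟨a, rfl⟩ := hp c
        rw [← hc, hf', LinearMap.mem_ker, LinearMap.comp_apply, hg', hgf]
      · intro hm
        rw [LinearMap.mem_ker, hg'] at hm
        have : m ∈ LinearMap.range f := hfg ▸ hm
        obtain ⟨a, rfl⟩ := this
        exact ⟨p a, hf' a⟩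

theorem mem_of_extClosed {W : Set (ModuleCat.{0} Λ)} (hz : HasZeroObj Λ W) (he : ExtClosed Λ W)
    (hB : B ⊆ W) {M : ModuleCat.{0} Λ} (h : IteratedExt B M) : M ∈ W := by
  induction h with
  | zero M h => exact hz M h
  | step f g hf hg hfg hA _ ih => exact he f g hf hg hfg (hB hA) ih

end IteratedExt

theorem iteratedExt_of_filtMem {B : Set (ModuleCat.{0} Λ)} {M : ModuleCat.{0} Λ}
    (h : FiltMem Λ B M) : IteratedExt B M := by
  obtain ⟨n, c, hc, h0, hn, hB⟩ := h
  have key : ∀ i : Fin (n + 1), IteratedExt B (ModuleCat.of Λ (c i)) := by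
    intro i
    induction i using Fin.induction with
    | zero =>
      rw [h0]
      exact .zero _ inferInstanceAs (Subsingleton (⊥ : Submodule Λ M))
    | succ i ih =>
      obtain ⟨N, hN, ⟨e⟩⟩ := hB i
      have hle : c i.castSucc ≤ c i.succ := hc i.castSucc_le_succ
      refine @IteratedExt.extClosed _ _ B (ModuleCat.of Λ (c i.castSucc))
        (ModuleCat.of Λ (c i.succ)) N (Submodule.inclusion hle)
        (e.toLinearMap ∘ₗ Submodule.mkQ _) (Submodule.inclusion_injective hle)
        (e.surjective.comp (Submodule.mkQ_surjective _)) ?_ ih (.of_mem hN)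
      rw [LinearEquiv.ker_comp, Submodule.ker_mkQ, Submodule.range_inclusion]
  have hlast := key (Fin.last n)
  rw [hn] at hlast
  exact hlast.congr Submodule.topEquiv

theorem filtMem_of_iteratedExt {B : Set (ModuleCat.{0} Λ)}
    {M : ModuleCat.{0} Λ} (h : IteratedExt B M) : FiltMem Λ B M := by
  induction h with
  | zero M h =>
    exact ⟨0, fun _ => ⊥, monotone_const, rfl, Subsingleton.elim _ _, fun i => i.elim0⟩
  | @step A M C f g hf hg hfg hA _ ih =>
    obtain ⟨n, d, hd, h0, hn, hd'⟩ := ih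
    refine ⟨n + 1, Fin.cons ⊥ fun i => (d i).comap g, ?_, rfl, ?_, ?_⟩
    · rw [Fin.monotone_iff_le_succ]
      intro i
      cases i using Fin.cases with
      | zero => exact bot_le
      | succ i => exact Submodule.comap_mono (hd i.castSucc_le_succ)
    · rw [← Fin.succ_last, Fin.cons_succ, hn, Submodule.comap_top]
    · intro i
      cases i using Fin.cases with
      | zero =>
        refine ⟨A, hA, ?_⟩
        change Nonempty ((↥((d 0).comap g) ⧸
          Submodule.comap ((d 0).comap g).subtype (⊥ : Submodule Λ M)) ≃ₗ[Λ] A)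
        rw [h0]
        have e : (LinearMap.range f) ≃ₗ[Λ] (Submodule.comap g ⊥) :=
          LinearEquiv.ofEq _ _ hfg
        refine nonempty_quotient_equiv
          ((LinearEquiv.ofInjective f hf).trans e).symm.toLinearMap
          (LinearEquiv.surjective _) _ ?_
        rw [LinearEquiv.ker]
        exact (Submodule.ker_subtype _).symm
      | succ i =>
        obtain ⟨N, hN, ⟨e⟩⟩ := hd' i
        refine ⟨N, hN, ?_⟩
        change Nonempty ((↥((d i.succ).comap g) ⧸
          Submodule.comap ((d i.succ).comap g).subtype ((d i.castSucc).comap g)) ≃ₗ[Λ] N)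
        refine nonempty_quotient_equiv (e.toLinearMap ∘ₗ Submodule.mkQ _ ∘ₗ
          g.restrict (p := (d i.succ).comap g) (q := d i.succ) fun _ h => h) ?_ _ ?_
        · refine e.surjective.comp ((Submodule.mkQ_surjective _).comp ?_)
          rintro ⟨y, hy⟩
          obtain ⟨x, rfl⟩ := hg y
          exact ⟨⟨x, hy⟩, rfl⟩
        · rw [LinearEquiv.ker_comp, LinearMap.ker_comp, Submodule.ker_mkQ]
          rfl

theorem filtClosure_eq (B : Set (ModuleCat.{0} Λ)) :
    filtClosure Λ B = {M | IteratedExt B M} :=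
  Set.ext fun _ => ⟨iteratedExt_of_filtMem, filtMem_of_iteratedExt⟩

end Filtrations

section Semibricks

variable {Λ}
variable {S : Set (ModuleCat.{0} Λ)}

namespace IsSemibrick

theorem bijective_of_ne_zero (hS : IsSemibrick Λ S) {A T : ModuleCat.{0} Λ} (hA : A ∈ S)
    (hT : T ∈ S) (f : A →ₗ[Λ] T) (hf : f ≠ 0) : Bijective f := by
  by_cases h : IsEmpty (A ≃ₗ[Λ] T)
  · exact absurd (hS.2.2 A hA T hT h f) hf
  · obtain ⟨e⟩ := not_isEmpty_iff.1 h
    have hb := (hS.1 A hA).2.2 (e.symm.toLinearMap ∘ₗ f) fun h0 => hf <| LinearMap.ext fun x =>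
      e.symm.injective (by simpa using LinearMap.congr_fun h0 x)
    simpa using e.bijective.comp hb

theorem injective_and_coker (hS : IsSemibrick Λ S) {A M : ModuleCat.{0} Λ} (hA : A ∈ S)
    (hM : IteratedExt S M) (f : A →ₗ[Λ] M) (hf : f ≠ 0) :
    Injective f ∧ IteratedExt S (ModuleCat.of Λ (M ⧸ LinearMap.range f)) := by
  induction hM with
  | zero M _ => exact absurd (LinearMap.ext fun x => Subsingleton.elim _ _) hf
  | @step T M C i g hi hg hig hT hC ih =>
    have hgi : ∀ t, g (i t) = 0 := fun t => by
      have : i t ∈ LinearMap.ker g := hig ▸ ⟨t, rfl⟩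
      exact this
    by_cases h0 : g ∘ₗ f = 0
    · obtain ⟨k, hk⟩ := exists_comp_eq_of_injective i hi f (by
        rw [hig]
        rintro _ ⟨a, rfl⟩
        exact LinearMap.congr_fun h0 a)
      have hkb := hS.bijective_of_ne_zero hA hT k fun h => hf <| LinearMap.ext fun a => by
        simp [← hk, h]
      obtain rfl : f = i ∘ₗ k := LinearMap.ext fun a => (hk a).symm
      refine ⟨hi.comp hkb.1, ?_⟩
      obtain ⟨e⟩ := nonempty_quotient_equiv g hg (LinearMap.range (i ∘ₗ k)) (by
        rw [LinearMap.range_comp_of_range_eq_top _ (LinearMap.range_eq_top.2 hkb.2), hig])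
      exact hC.congr e.symm
    · obtain ⟨hinj, hcok⟩ := ih (g ∘ₗ f) h0
      refine ⟨Injective.of_comp (f := g) hinj, ?_⟩
      obtain ⟨p, hp⟩ := exists_comp_eq_of_surjective (LinearMap.range f).mkQ
        (Submodule.mkQ_surjective _) ((LinearMap.range (g ∘ₗ f)).mkQ ∘ₗ g) (by
          rw [Submodule.ker_mkQ]
          rintro _ ⟨a, rfl⟩
          simp only [LinearMap.mem_ker, LinearMap.comp_apply, Submodule.mkQ_apply,
            Submodule.Quotient.mk_eq_zero]
          exact ⟨a, rfl⟩)
      refine .step (M := ModuleCat.of Λ (M ⧸ LinearMap.range f)) ((LinearMap.range f).mkQ ∘ₗ i) p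
        ?_ ?_ ?_ hT hcok
      · rw [injective_iff_map_eq_zero]
        intro t ht
        simp only [LinearMap.comp_apply, Submodule.mkQ_apply, Submodule.Quotient.mk_eq_zero] at ht
        obtain ⟨a, ha⟩ := ht
        have ha0 : a = 0 := hinj (by simp [ha, hgi])
        exact hi (by simp [← ha, ha0])
      · intro y
        obtain ⟨c, rfl⟩ := Submodule.mkQ_surjective _ y
        obtain ⟨m, rfl⟩ := hg c
        exact ⟨(LinearMap.range f).mkQ m, hp m⟩
      · ext x
        obtain ⟨m, rfl⟩ := Submodule.mkQ_surjective _ x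
        rw [LinearMap.mem_ker, hp]
        simp only [LinearMap.comp_apply, Submodule.mkQ_apply, Submodule.Quotient.mk_eq_zero,
          LinearMap.mem_range]
        constructor
        · rintro ⟨t, ht⟩
          obtain ⟨a, ha⟩ := (Submodule.Quotient.eq _).1 ht
          exact ⟨-a, by simp [ha, hgi]⟩
        · rintro ⟨a, ha⟩
          have : m - f a ∈ LinearMap.range i := by simp [hig, ha]
          obtain ⟨t, ht⟩ := this
          exact ⟨t, (Submodule.Quotient.eq _).2 ⟨-a, by simp [ht]⟩⟩

theorem ker_and_coker (hS : IsSemibrick Λ S) {M : ModuleCat.{0} Λ} (hM : IteratedExt S M)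
    {N : ModuleCat.{0} Λ} (hN : IteratedExt S N) (f : M →ₗ[Λ] N) :
    IteratedExt S (ModuleCat.of Λ (LinearMap.ker f)) ∧
      IteratedExt S (ModuleCat.of Λ (N ⧸ LinearMap.range f)) := by
  induction hM generalizing N with
  | zero M _ =>
    refine ⟨.zero _ inferInstanceAs (Subsingleton (LinearMap.ker f)), ?_⟩
    obtain rfl : f = 0 := LinearMap.ext fun x => by rw [Subsingleton.elim x 0]; simp
    rw [LinearMap.range_zero]
    exact hN.congr (Submodule.quotEquivOfEqBot _ rfl).symm
  | @step A M C i g hi hg hig hA hC ih =>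
    have hgi : ∀ t, g (i t) = 0 := fun t => by
      have : i t ∈ LinearMap.ker g := hig ▸ ⟨t, rfl⟩
      exact this
    by_cases h0 : f ∘ₗ i = 0
    · have hfi : ∀ a, f (i a) = 0 := LinearMap.congr_fun h0
      obtain ⟨k, hk⟩ := exists_comp_eq_of_surjective g hg f (by
        rw [← hig]
        rintro _ ⟨a, rfl⟩
        exact hfi a)
      obtain ⟨hker, hcok⟩ := ih hN k
      constructor
      · refine .step (M := ModuleCat.of Λ (LinearMap.ker f)) (i.codRestrict _ hfi)
          (g.restrict (p := LinearMap.ker f) (q := LinearMap.ker k) fun x hx => by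
            rwa [LinearMap.mem_ker, hk]) ?_ ?_ ?_ hA hker
        · exact fun a b h => hi (congrArg Subtype.val h)
        · rintro ⟨c, hc⟩
          obtain ⟨m, rfl⟩ := hg c
          exact ⟨⟨m, (hk m).symm.trans hc⟩, rfl⟩
        · ext ⟨m, hm⟩
          have := SetLike.ext_iff.1 hig m
          rw [LinearMap.mem_range, LinearMap.mem_ker] at this ⊢
          simp only [Subtype.ext_iff]
          exact this
      · have : LinearMap.range f = LinearMap.range k := by
          rw [show f = k ∘ₗ g from LinearMap.ext fun m => (hk m).symm]
          exact LinearMap.range_comp_of_range_eq_top _ (LinearMap.range_eq_top.2 hg)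
        rw [this]
        exact hcok
    · obtain ⟨hinj, hD⟩ := hS.injective_and_coker hA hN (f ∘ₗ i) h0
      let Q := LinearMap.range (f ∘ₗ i)
      obtain ⟨k, hk⟩ := exists_comp_eq_of_surjective g hg (Q.mkQ ∘ₗ f) (by
        rw [← hig]
        rintro _ ⟨a, rfl⟩
        simp only [LinearMap.mem_ker, LinearMap.comp_apply, Submodule.mkQ_apply,
          Submodule.Quotient.mk_eq_zero]
        exact ⟨a, rfl⟩)
      obtain ⟨hker, hcok⟩ := ih hD k
      constructor
      · let r : LinearMap.ker f →ₗ[Λ] LinearMap.ker k := g.restrict fun x hx => by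
          rw [LinearMap.mem_ker, hk, LinearMap.comp_apply, LinearMap.mem_ker.1 hx, map_zero]
        refine hker.congr (LinearEquiv.ofBijective r ⟨?_, ?_⟩).symm
        · rw [injective_iff_map_eq_zero]
          rintro ⟨m, hm⟩ h
          have hgm : m ∈ LinearMap.ker g := congrArg Subtype.val h
          rw [← hig] at hgm
          obtain ⟨a, rfl⟩ := hgm
          have ha : a = 0 := hinj (by simpa using hm)
          simp [ha]
        · rintro ⟨c, hc⟩
          obtain ⟨m, rfl⟩ := hg c
          rw [LinearMap.mem_ker, hk] at hc
          obtain ⟨a, ha⟩ := (Submodule.Quotient.mk_eq_zero Q).1 hc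
          refine ⟨⟨m - i a, ?_⟩, Subtype.ext ?_⟩
          · rw [LinearMap.mem_ker, map_sub, ← ha, LinearMap.comp_apply, sub_self]
          · change g (m - i a) = g m
            rw [map_sub, hgi, sub_zero]
      · obtain ⟨e⟩ := nonempty_quotient_equiv ((LinearMap.range k).mkQ ∘ₗ Q.mkQ)
          ((Submodule.mkQ_surjective _).comp Q.mkQ_surjective) (LinearMap.range f) (by
            ext n
            simp only [LinearMap.mem_ker, LinearMap.comp_apply, Submodule.mkQ_apply,
              Submodule.Quotient.mk_eq_zero]
            constructor
            · rintro ⟨c, hc⟩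
              obtain ⟨m, rfl⟩ := hg c
              rw [hk] at hc
              obtain ⟨a, ha⟩ := (Submodule.Quotient.eq Q).1 hc
              exact ⟨m - i a, by rw [map_sub, ← LinearMap.comp_apply, ha]; exact sub_sub_cancel _ _⟩
            · rintro ⟨m, rfl⟩
              exact ⟨g m, hk m⟩)
        exact hcok.congr e.symm

theorem isWide_iteratedExt [IsNoetherianRing Λ] (hS : IsSemibrick Λ S) :
    IsWide Λ {M | IteratedExt S M} := by
  refine ⟨fun M hM => ?_, fun M N ⟨e⟩ hM => IteratedExt.congr e hM, fun M h => .zero M h,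
    fun M N f hM hN => (hS.ker_and_coker hM hN f).1,
    fun M N f hM hN => (hS.ker_and_coker hM hN f).2, IteratedExt.extClosed⟩
  suffices IsNoetherian Λ M from inferInstance
  refine IteratedExt.mem_of_extClosed (W := {M | IsNoetherian Λ M}) (fun M _ => ?_)
    (fun A M C f g _ _ hfg hA hC => ?_) (fun M hM => ?_) hM
  · exact inferInstanceAs (IsNoetherian Λ M)
  · change IsNoetherian Λ A at hA
    change IsNoetherian Λ C at hC
    exact isNoetherian_of_range_eq_ker f g hfg
  · have := (hS.1 M hM).1
    exact inferInstanceAs (IsNoetherian Λ M)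

theorem simOf_iteratedExt (hS : IsSemibrick Λ S) : simOf Λ {M | IteratedExt S M} = S := by
  ext M
  constructor
  · rintro ⟨hM, hnt, hsub⟩
    cases hM with
    | zero _ h => exact absurd h (not_subsingleton M)
    | @step A _ C f g hf hg hfg hA hC =>
      have := (hS.1 A hA).2.1
      rcases hsub A f (.of_mem hA) hf with h | h
      · obtain ⟨a, ha⟩ := exists_ne (0 : A)
        refine absurd (hf ?_) ha
        rw [LinearMap.range_eq_bot.1 h]
        simp
      · exact hS.2.1 ⟨LinearEquiv.ofBijective f ⟨hf, LinearMap.range_eq_top.1 h⟩⟩ hA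
  · intro hM
    refine ⟨.of_mem hM, (hS.1 M hM).2.1, fun X f hX hf => ?_⟩
    cases hX with
    | zero _ h =>
      left
      rw [LinearMap.range_eq_bot]
      exact LinearMap.ext fun x => by rw [Subsingleton.elim x 0]; simp
    | @step A _ C i g hi hg hig hA hC =>
      right
      have := (hS.1 A hA).2.1
      have hb := hS.bijective_of_ne_zero hA hM (f ∘ₗ i) fun h => by
        obtain ⟨a, ha⟩ := exists_ne (0 : A)
        exact ha ((hf.comp hi) (by simpa using LinearMap.congr_fun h a))
      exact LinearMap.range_eq_top.2 (Surjective.of_comp (g := i) hb.2)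

end IsSemibrick

end Semibricks

section Wide

variable {Λ}
variable {W : Set (ModuleCat.{0} Λ)}

theorem simOf_isoClosed (hW : IsoClosed Λ W) : IsoClosed Λ (simOf Λ W) := by
  rintro M N ⟨e⟩ ⟨hM, _, hsub⟩
  refine ⟨hW ⟨e⟩ hM, e.symm.toEquiv.nontrivial, fun X f hX hf => ?_⟩
  refine (hsub X (e.symm.toLinearMap ∘ₗ f) hX (e.symm.injective.comp hf)).imp (fun h => ?_)
    fun h => ?_
  · rw [LinearMap.range_eq_bot] at h ⊢
    exact LinearMap.ext fun x => e.symm.injective (by simpa using LinearMap.congr_fun h x)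
  · rw [LinearMap.range_eq_top] at h ⊢
    simpa using e.surjective.comp h

namespace IsWide

theorem bijective_of_ne_zero (hW : IsWide Λ W) {M N : ModuleCat.{0} Λ} (hM : M ∈ simOf Λ W)
    (hN : N ∈ simOf Λ W) (f : M →ₗ[Λ] N) (hf : f ≠ 0) : Bijective f := by
  have hinj : Injective f := by
    rcases hM.2.2 (ModuleCat.of Λ (LinearMap.ker f)) (LinearMap.ker f).subtype
      (hW.2.2.2.1 f hM.1 hN.1) (Submodule.subtype_injective _) with h | h
    · rw [Submodule.range_subtype] at h
      exact LinearMap.ker_eq_bot.1 h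
    · rw [Submodule.range_subtype] at h
      exact absurd (LinearMap.ker_eq_top.1 h) hf
  refine ⟨hinj, ?_⟩
  rcases hN.2.2 M f hM.1 hinj with h | h
  · exact absurd (LinearMap.range_eq_bot.1 h) hf
  · exact LinearMap.range_eq_top.1 h

theorem isSemibrick_simOf (hW : IsWide Λ W) : IsSemibrick Λ (simOf Λ W) :=
  ⟨fun M hM => ⟨hW.1 M hM.1, hM.2.1, hW.bijective_of_ne_zero hM hM⟩, simOf_isoClosed hW.2.1,
    fun _ hM _ hN h f => by_contra fun hf =>
      h.false (LinearEquiv.ofBijective f (hW.bijective_of_ne_zero hM hN f hf))⟩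

theorem exists_simple_submodule [IsArtinianRing Λ] (hW : IsWide Λ W) {M : ModuleCat.{0} Λ}
    (hM : M ∈ W) (hnt : Nontrivial M) :
    ∃ p : Submodule Λ M, ModuleCat.of Λ p ∈ simOf Λ W := by
  have := hW.1 M hM
  obtain ⟨p, ⟨hp, hp0⟩, hmin⟩ := WellFounded.has_min (wellFounded_lt (α := Submodule Λ M))
    {p | ModuleCat.of Λ p ∈ W ∧ p ≠ ⊥} ⟨⊤, hW.2.1 ⟨Submodule.topEquiv.symm⟩ hM, top_ne_bot⟩
  refine ⟨p, hp, (Submodule.nontrivial_iff_ne_bot).2 hp0, fun X f hX hf => ?_⟩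
  by_contra! h
  let f' : X →ₗ[Λ] p := f
  let q := LinearMap.range (p.subtype ∘ₗ f')
  have hf' : Injective (p.subtype ∘ₗ f') := p.subtype_injective.comp hf
  have hqp : q ≤ p := by
    rintro _ ⟨x, rfl⟩
    exact (f' x).2
  refine hmin q ⟨hW.2.1 ⟨LinearEquiv.ofInjective _ hf'⟩ hX, fun hq => h.1 ?_⟩
    (hqp.lt_of_ne fun hq => h.2 ?_)
  · rw [LinearMap.range_eq_bot] at hq ⊢
    exact LinearMap.ext fun x => Subtype.ext (LinearMap.congr_fun hq x)
  · refine LinearMap.range_eq_top.2 fun ⟨y, hy⟩ => ?_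
    rw [← hq] at hy
    obtain ⟨x, hx⟩ := hy
    exact ⟨x, Subtype.ext hx⟩

theorem iteratedExt_simOf [IsArtinianRing Λ] [IsNoetherianRing Λ] (hW : IsWide Λ W)
    {M : ModuleCat.{0} Λ} (hM : M ∈ W) : IteratedExt (simOf Λ W) M := by
  have := hW.1 M hM
  suffices ∀ (p : Submodule Λ M) (N : ModuleCat.{0} Λ) (g : M →ₗ[Λ] N), N ∈ W → Surjective g →
      LinearMap.ker g = p → IteratedExt (simOf Λ W) N from
    this ⊥ M LinearMap.id hM surjective_id LinearMap.ker_id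
  intro p
  induction p using WellFoundedGT.induction with
  | ind p ih =>
    intro N g hN hg hp
    rcases subsingleton_or_nontrivial N with h | hnt
    · exact .zero _ h
    obtain ⟨s, hs⟩ := hW.exists_simple_submodule hN hnt
    have hs0 : s ≠ ⊥ := (Submodule.nontrivial_iff_ne_bot).1 hs.2.1
    have hQ : ModuleCat.of Λ (N ⧸ s) ∈ W := by
      have := hW.2.2.2.2.1 (M := ModuleCat.of Λ s) s.subtype hs.1 hN
      rwa [Submodule.range_subtype] at this
    refine .step (A := ModuleCat.of Λ s) (C := ModuleCat.of Λ (N ⧸ s)) s.subtype s.mkQ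
      s.subtype_injective s.mkQ_surjective (by rw [Submodule.range_subtype, Submodule.ker_mkQ]) hs
      (ih (s.comap g) ?_ (ModuleCat.of Λ (N ⧸ s)) (s.mkQ ∘ₗ g) hQ (s.mkQ_surjective.comp hg)
        (by rw [LinearMap.ker_comp, Submodule.ker_mkQ]))
    rw [← hp]
    exact Submodule.comap_strictMono_of_surjective hg (bot_lt_iff_ne_bot.2 hs0)

end IsWide

end Wide

/-- (Ringel) `W ↦ sim(W)` and `S ↦ Filt(S)` are mutually inverse bijections
between wide subcategories of `mod Λ` and semibricks in `mod Λ`. -/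
theorem wide_subcategories_biject_with_semibricks
    (K Λ : Type) [Field K] [Ring Λ] [Algebra K Λ] [FiniteDimensional K Λ] :
    (∀ W, IsWide Λ W → IsSemibrick Λ (simOf Λ W) ∧ filtClosure Λ (simOf Λ W) = W) ∧
    (∀ S, IsSemibrick Λ S → IsWide Λ (filtClosure Λ S) ∧ simOf Λ (filtClosure Λ S) = S) := by
  have : IsNoetherianRing Λ := IsNoetherianRing.of_finite K Λ
  have : IsArtinianRing Λ := IsArtinianRing.of_finite K Λ
  refine ⟨fun W hW => ⟨hW.isSemibrick_simOf, ?_⟩, fun S hS => ?_⟩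
  · rw [filtClosure_eq]
    exact Set.ext fun M => ⟨IteratedExt.mem_of_extClosed hW.2.2.1 hW.2.2.2.2.2 fun _ h => h.1,
      hW.iteratedExt_simOf⟩
  · rw [filtClosure_eq]
    exact ⟨hS.isWide_iteratedExt, hS.simOf_iteratedExt⟩

end BrickPaper
end

section
/- Let Λ be a finite-dimensional algebra over a field K and let T be a torsion class in mod Λ. Then the map M ↦ Filt(T ∪ {M}) is a bijection from the set ME(T) of isomorphism classes of minimal extending modules for T to the set of torsion classes T' in mod Λ that cover T. -/
open Function DirectSum

namespace BrickPaper

variable (Λ : Type) [Ring Λ]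

section Filtrations

variable {Λ}

/-- A map whose kernel contains that of a surjection `g` factors through `g`. -/
lemma exists_factor_of_ker_le {X N W : Type} [AddCommGroup X] [AddCommGroup N] [AddCommGroup W]
    [Module Λ X] [Module Λ N] [Module Λ W] (g : X →ₗ[Λ] N) (hg : Surjective g)
    (h : X →ₗ[Λ] W) (hk : LinearMap.ker g ≤ LinearMap.ker h) :
    ∃ k : N →ₗ[Λ] W, ∀ x, k (g x) = h x := by
  refine ⟨(LinearMap.ker g).liftQ h hk ∘ₗ (g.quotKerEquivOfSurjective hg).symm, fun x => ?_⟩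
  have : (g.quotKerEquivOfSurjective hg).symm (g x) = (LinearMap.ker g).mkQ x := by
    rw [LinearEquiv.symm_apply_eq]
    rfl
  simp [this]

lemma FiltMem.of_subsingleton {B : Set (ModuleCat.{0} Λ)} (M : ModuleCat.{0} Λ)
    [Subsingleton M] : FiltMem Λ B M :=
  ⟨0, fun _ => ⊥, monotone_const, rfl, Subsingleton.elim _ _, fun i => i.elim0⟩

/-- Extending a filtration by one more layer on top. -/
lemma FiltMem.extend {B : Set (ModuleCat.{0} Λ)} {A M N : ModuleCat.{0} Λ}
    (f : A →ₗ[Λ] M) (g : M →ₗ[Λ] N) (hf : Injective f) (hg : Surjective g)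
    (hfg : LinearMap.range f = LinearMap.ker g) (hN : N ∈ B) (hA : FiltMem Λ B A) :
    FiltMem Λ B M := by
  have transport : ∀ {U V U' V' : Submodule Λ M} {L : ModuleCat.{0} Λ}, U = U' → V = V' →
      Nonempty ((U' ⧸ V'.comap U'.subtype) ≃ₗ[Λ] L) →
      Nonempty ((U ⧸ V.comap U.subtype) ≃ₗ[Λ] L) := by
    rintro U V _ _ L rfl rfl h
    exact h
  obtain ⟨n, c, hc, h0, h1, hq⟩ := hA
  refine ⟨n + 1, Fin.snoc (α := fun _ => Submodule Λ M) (fun i => (c i).map f) ⊤,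
    ?_, ?_, ?_, ?_⟩
  · intro i j hij
    induction j using Fin.lastCases with
    | last => simp
    | cast j =>
      induction i using Fin.lastCases with
      | last => exact absurd hij (not_le.2 (Fin.castSucc_lt_last j))
      | cast i =>
        simp only [Fin.snoc_castSucc]
        exact Submodule.map_mono (hc (Fin.castSucc_le_castSucc_iff.1 hij))
  · rw [← Fin.castSucc_zero, Fin.snoc_castSucc, h0, Submodule.map_bot]
  · simp
  · intro i
    induction i using Fin.lastCases with
    | last =>
      refine ⟨N, hN, transport (U' := ⊤) (V' := LinearMap.ker g) (by simp)
        (by rw [Fin.snoc_castSucc, h1, Submodule.map_top, hfg]) ?_⟩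
      have hs : Surjective (g ∘ₗ (⊤ : Submodule Λ M).subtype) := fun y => by
        obtain ⟨x, rfl⟩ := hg y
        exact ⟨⟨x, trivial⟩, rfl⟩
      exact ⟨(Submodule.quotEquivOfEq _ _ (LinearMap.ker_comp _ _).symm).trans
        (LinearMap.quotKerEquivOfSurjective (g ∘ₗ (⊤ : Submodule Λ M).subtype) hs)⟩
    | cast i =>
      obtain ⟨L, hL, ⟨e⟩⟩ := hq i
      refine ⟨L, hL, transport (U' := (c i.succ).map f) (V' := (c i.castSucc).map f)
        (by rw [Fin.succ_castSucc, Fin.snoc_castSucc]) (by rw [Fin.snoc_castSucc]) ?_⟩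
      refine ⟨(Submodule.Quotient.equiv _ _
        (Submodule.equivMapOfInjective f hf (c i.succ)) ?_).symm.trans e⟩
      ext ⟨y, hy⟩
      constructor
      · rintro ⟨x, hx, hxy⟩
        rw [← hxy]
        exact ⟨x, hx, rfl⟩
      · rintro ⟨x, hx, hxy⟩
        exact ⟨⟨x, hc i.castSucc_lt_succ.le hx⟩, hx, Subtype.ext hxy⟩

/-- Induction along a filtration. -/
lemma FiltMem.induction {B : Set (ModuleCat.{0} Λ)} {P : ModuleCat.{0} Λ → Prop}
    (iso : ∀ M N : ModuleCat.{0} Λ, (M ≃ₗ[Λ] N) → P M → P N)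
    (zero : ∀ M : ModuleCat.{0} Λ, Subsingleton M → P M)
    (step : ∀ (A M N : ModuleCat.{0} Λ) (f : A →ₗ[Λ] M) (g : M →ₗ[Λ] N),
      Injective f → Surjective g → LinearMap.range f = LinearMap.ker g → N ∈ B → P A → P M)
    {M : ModuleCat.{0} Λ} (hM : FiltMem Λ B M) : P M := by
  obtain ⟨n, c, hc, h0, h1, hq⟩ := hM
  have key : ∀ i, P (ModuleCat.of Λ (c i)) := by
    intro i
    induction i using Fin.induction with
    | zero =>
      apply zero
      rw [h0]
      exact inferInstanceAs (Subsingleton (⊥ : Submodule Λ M))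
    | succ i ih =>
      obtain ⟨N, hN, ⟨e⟩⟩ := hq i
      refine step (ModuleCat.of Λ (c i.castSucc)) (ModuleCat.of Λ (c i.succ)) N
        (Submodule.inclusion (hc i.castSucc_lt_succ.le))
        (e.toLinearMap ∘ₗ Submodule.mkQ _) (Submodule.inclusion_injective _)
        (e.surjective.comp (Submodule.mkQ_surjective _)) ?_ hN ih
      rw [LinearEquiv.ker_comp, Submodule.ker_mkQ]
      exact Submodule.range_inclusion _ _ _
  have := key (Fin.last n)
  rw [h1] at this
  exact iso (ModuleCat.of Λ (⊤ : Submodule Λ M)) M Submodule.topEquiv this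

lemma FiltMem.of_equiv {B : Set (ModuleCat.{0} Λ)} (hB : HasZeroObj Λ B)
    {M N : ModuleCat.{0} Λ} (e : M ≃ₗ[Λ] N) (hM : FiltMem Λ B M) : FiltMem Λ B N :=
  hM.extend (N := ModuleCat.of Λ PUnit) e.toLinearMap 0 e.injective
    (fun _ => ⟨0, rfl⟩) (by simp) (hB _ (inferInstanceAs (Subsingleton PUnit)))

lemma FiltMem.of_mem {B : Set (ModuleCat.{0} Λ)} {N : ModuleCat.{0} Λ} (hN : N ∈ B) :
    FiltMem Λ B N :=
  have : Subsingleton (ModuleCat.of Λ PUnit) := inferInstanceAs (Subsingleton PUnit)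
  (FiltMem.of_subsingleton (ModuleCat.of Λ PUnit)).extend (N := N) 0 LinearMap.id
    (fun _ _ _ => Subsingleton.elim _ _) surjective_id (by simp) hN

lemma extClosed_filtClosure {B : Set (ModuleCat.{0} Λ)} (hB : HasZeroObj Λ B) :
    ExtClosed Λ (filtClosure Λ B) := by
  intro A M C f g hf hg hfg hA hC
  revert A M
  refine FiltMem.induction (B := B) (P := fun C => ∀ (A M : ModuleCat.{0} Λ) (f : A →ₗ[Λ] M)
    (g : M →ₗ[Λ] C), Injective f → Surjective g → LinearMap.range f = LinearMap.ker g →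
    FiltMem Λ B A → FiltMem Λ B M) ?_ ?_ ?_ hC
  · intro C D e ih A M f g hf hg hfg hA
    exact ih A M f (e.symm.toLinearMap ∘ₗ g) hf (e.symm.surjective.comp hg)
      (by rw [LinearEquiv.ker_comp, hfg]) hA
  · intro C hC A M f g hf hg hfg hA
    refine hA.of_equiv hB (LinearEquiv.ofBijective f ⟨hf, ?_⟩)
    rw [← LinearMap.range_eq_top, hfg, LinearMap.ker_eq_top]
    ext x
    exact Subsingleton.elim _ _
  · intro C' C N f' g' hf' hg' hfg' hN ih A M f g hf hg hfg hA
    have hgf : ∀ a, g (f a) = 0 := fun a => by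
      rw [← LinearMap.mem_ker, ← hfg]
      exact ⟨a, rfl⟩
    let M' := (LinearMap.range f').comap g
    let e := LinearEquiv.ofInjective f' hf'
    have hM' : FiltMem Λ B (ModuleCat.of Λ M') := by
      refine ih A (ModuleCat.of Λ M')
        (f.codRestrict M' fun a => by simp [M', hgf])
        (e.symm.toLinearMap ∘ₗ g.restrict fun x hx => hx) ?_ ?_ ?_ hA
      · exact fun a b hab => hf (congrArg Subtype.val hab)
      · refine e.symm.surjective.comp ?_
        rintro ⟨y, hy⟩
        obtain ⟨x, rfl⟩ := hg y
        exact ⟨⟨x, hy⟩, rfl⟩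
      · rw [LinearEquiv.ker_comp]
        ext ⟨x, hx⟩
        have : x ∈ LinearMap.range f ↔ x ∈ LinearMap.ker g := by rw [hfg]
        constructor
        · rintro ⟨a, ha⟩
          exact Subtype.ext (this.1 ⟨a, congrArg Subtype.val ha⟩)
        · intro h
          obtain ⟨a, ha⟩ := this.2 (congrArg Subtype.val h)
          exact ⟨a, Subtype.ext ha⟩
    refine hM'.extend (A := ModuleCat.of Λ M') (M := M) M'.subtype (g' ∘ₗ g)
      Subtype.val_injective (hg'.comp hg) ?_ hN
    rw [LinearMap.ker_comp, ← hfg']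
    exact M'.range_subtype

lemma quotClosed_filtClosure {B : Set (ModuleCat.{0} Λ)}
    (hq : ∀ N ∈ B, ∀ (Z : ModuleCat.{0} Λ) (g : N →ₗ[Λ] Z), Surjective g →
      ∃ N' ∈ B, Nonempty (Z ≃ₗ[Λ] N')) :
    QuotClosed Λ (filtClosure Λ B) := by
  intro X Z q hqs hX
  revert Z
  refine FiltMem.induction (B := B) (P := fun X => ∀ (Z : ModuleCat.{0} Λ) (q : X →ₗ[Λ] Z),
    Surjective q → FiltMem Λ B Z) ?_ ?_ ?_ hX
  · intro M N e ih Z q hq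
    exact ih Z (q ∘ₗ e.toLinearMap) (hq.comp e.surjective)
  · intro M hM Z q hq
    have : Subsingleton Z := hq.subsingleton
    exact FiltMem.of_subsingleton Z
  · intro A X N f g hf hg hfg hN ih Z q hqs
    let A' := LinearMap.range (q ∘ₗ f)
    have hA' : FiltMem Λ B (ModuleCat.of Λ A') :=
      ih (ModuleCat.of Λ A') (q ∘ₗ f).rangeRestrict (LinearMap.surjective_rangeRestrict _)
    obtain ⟨k, hk⟩ := exists_factor_of_ker_le g hg (A'.mkQ ∘ₗ q) (by
      rw [← hfg]
      rintro _ ⟨a, rfl⟩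
      simp [A'])
    have hks : Surjective k := by
      intro w
      obtain ⟨z, rfl⟩ := A'.mkQ_surjective w
      obtain ⟨x, rfl⟩ := hqs z
      exact ⟨g x, hk x⟩
    obtain ⟨N', hN', ⟨e⟩⟩ := hq N hN (ModuleCat.of Λ (Z ⧸ A')) k hks
    refine hA'.extend (A := ModuleCat.of Λ A') A'.subtype (e.toLinearMap ∘ₗ A'.mkQ)
      Subtype.val_injective (e.surjective.comp A'.mkQ_surjective) ?_ hN'
    rw [LinearEquiv.ker_comp, Submodule.ker_mkQ]
    exact A'.range_subtype

lemma finite_of_filtMem {B : Set (ModuleCat.{0} Λ)} (hB : ∀ N ∈ B, FG Λ N)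
    {M : ModuleCat.{0} Λ} (hM : FiltMem Λ B M) : FG Λ M := by
  refine FiltMem.induction (B := B) (P := fun M => FG Λ M) ?_ ?_ ?_ hM
  · intro M N e h
    exact Module.Finite.equiv e
  · intro M hM
    exact inferInstance
  · intro A M N f g hf hg hfg hN hA
    have := hB N hN
    have : Module.Finite Λ (LinearMap.ker g) := by
      rw [← hfg]
      infer_instance
    have := Module.Finite.equiv (g.quotKerEquivOfSurjective hg).symm
    exact Module.Finite.of_submodule_quotient (LinearMap.ker g)

lemma filtClosure_subset {B C : Set (ModuleCat.{0} Λ)} (hC : IsTorsionClass Λ C) (hBC : B ⊆ C) :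
    filtClosure Λ B ⊆ C := fun _ hM =>
  FiltMem.induction (B := B) (P := fun M => M ∈ C) (fun _ _ e h => hC.2.1 ⟨e⟩ h)
    (fun M hM => hC.2.2.1 M hM)
    (fun _ _ _ f g hf hg hfg hN hA => hC.2.2.2.2 f g hf hg hfg hA (hBC hN)) hM

end Filtrations

section MinimalExtending

variable {Λ} {T : Set (ModuleCat.{0} Λ)}

/-- If all proper quotients of `M` lie in `T`, then `Filt (T ∪ {M})` is a torsion class. -/
lemma isTorsionClass_filtClosure_union_singleton (hT : IsTorsionClass Λ T)
    {M : ModuleCat.{0} Λ} (hM : FG Λ M)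
    (hq : ∀ S : Submodule Λ M, S ≠ ⊥ → ModuleCat.of Λ ((M : Type) ⧸ S) ∈ T) :
    IsTorsionClass Λ (filtClosure Λ (T ∪ {M})) := by
  have h0 : HasZeroObj Λ (T ∪ {M}) := fun N hN => Or.inl (hT.2.2.1 N hN)
  refine ⟨fun N hN => finite_of_filtMem ?_ hN, fun N N' ⟨e⟩ hN => hN.of_equiv h0 e,
    fun N hN => FiltMem.of_subsingleton N, quotClosed_filtClosure ?_, extClosed_filtClosure h0⟩
  · rintro N (hN | rfl)
    exacts [hT.1 N hN, hM]
  · rintro N (hN | rfl) Z g hg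
    · exact ⟨Z, Or.inl (hT.2.2.2.1 g hg hN), ⟨LinearEquiv.refl Λ Z⟩⟩
    · by_cases hk : LinearMap.ker g = ⊥
      · exact ⟨N, Or.inr rfl,
          ⟨(LinearEquiv.ofBijective g ⟨LinearMap.ker_eq_bot.1 hk, hg⟩).symm⟩⟩
      · exact ⟨_, Or.inl (hq _ hk), ⟨(g.quotKerEquivOfSurjective hg).symm⟩⟩

/-- The quotient of an extension of `T₀` by `Y` by a submodule of `Y` with quotient `N` is an
extension of `T₀` by `N`. -/
lemma exists_quotient_extension {A Y N X T₀ : ModuleCat.{0} Λ}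
    (f' : A →ₗ[Λ] Y) (g' : Y →ₗ[Λ] N) (hg' : Surjective g')
    (hfg' : LinearMap.range f' = LinearMap.ker g')
    (f : Y →ₗ[Λ] X) (g : X →ₗ[Λ] T₀) (hf : Injective f) (hg : Surjective g)
    (hfg : LinearMap.range f = LinearMap.ker g) :
    ∃ (W : ModuleCat.{0} Λ) (p : X →ₗ[Λ] W) (k : N →ₗ[Λ] W) (l : W →ₗ[Λ] T₀),
      Surjective p ∧ LinearMap.range (f ∘ₗ f') = LinearMap.ker p ∧ Injective k ∧
      Surjective l ∧ LinearMap.range k = LinearMap.ker l ∧ ∀ y, k (g' y) = p (f y) := by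
  have hfg_apply : ∀ y, g (f y) = 0 := fun y => by
    rw [← LinearMap.mem_ker, ← hfg]
    exact ⟨y, rfl⟩
  let R := LinearMap.range (f ∘ₗ f')
  obtain ⟨k, hk⟩ := exists_factor_of_ker_le g' hg' (R.mkQ ∘ₗ f) (by
    rw [← hfg']
    rintro _ ⟨a, rfl⟩
    simp [R])
  obtain ⟨l, hl⟩ := exists_factor_of_ker_le R.mkQ R.mkQ_surjective g (by
    rw [Submodule.ker_mkQ]
    rintro _ ⟨a, rfl⟩
    simp [hfg_apply])
  refine ⟨ModuleCat.of Λ (X ⧸ R), R.mkQ, k, l, R.mkQ_surjective, R.ker_mkQ.symm, ?_, ?_, ?_, hk⟩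
  · rw [injective_iff_map_eq_zero]
    intro n hn
    obtain ⟨y, rfl⟩ := hg' n
    rw [hk, LinearMap.comp_apply, ← LinearMap.mem_ker, Submodule.ker_mkQ] at hn
    obtain ⟨a, ha⟩ := hn
    rw [← hf ha, ← LinearMap.mem_ker, ← hfg']
    exact ⟨a, rfl⟩
  · intro t
    obtain ⟨x, rfl⟩ := hg t
    exact ⟨_, hl x⟩
  · ext w
    obtain ⟨x, rfl⟩ := R.mkQ_surjective w
    constructor
    · rintro ⟨n, hn⟩
      obtain ⟨y, rfl⟩ := hg' n
      rw [← hn, hk, LinearMap.mem_ker]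
      exact (hl _).trans (hfg_apply y)
    · intro h
      have hx : x ∈ LinearMap.ker g := (hl x).symm.trans h
      rw [← hfg] at hx
      obtain ⟨y, rfl⟩ := hx
      exact ⟨g' y, hk y⟩

/-- Every object of `Filt (T ∪ {M})` outside `T` surjects onto the minimal extending
module `M`. -/
lemma exists_surjective_of_mem_filtClosure (hT : IsTorsionClass Λ T)
    {M : ModuleCat.{0} Λ} (hM : IsMinExt Λ T M) {X : ModuleCat.{0} Λ}
    (hX : X ∈ filtClosure Λ (T ∪ {M})) (hXT : X ∉ T) :
    ∃ p : X →ₗ[Λ] M, Surjective p := by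
  refine FiltMem.induction (B := T ∪ {M}) (P := fun Y => ∀ (X T₀ : ModuleCat.{0} Λ)
    (f : Y →ₗ[Λ] X) (g : X →ₗ[Λ] T₀), Injective f → Surjective g →
    LinearMap.range f = LinearMap.ker g → T₀ ∈ T → X ∉ T → ∃ p : X →ₗ[Λ] M, Surjective p)
    ?_ ?_ ?_ hX X (ModuleCat.of Λ PUnit) LinearMap.id 0 injective_id (fun _ => ⟨0, rfl⟩)
    (by simp) (hT.2.2.1 _ (inferInstanceAs (Subsingleton PUnit))) hXT
  · intro Y Y' e ih X T₀ f g hf hg hfg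
    exact ih X T₀ (f ∘ₗ e.toLinearMap) g (hf.comp e.injective) hg
      (by rw [LinearEquiv.range_comp, hfg])
  · intro Y hY X T₀ f g hf hg hfg hT₀ hX
    refine absurd (hT.2.1 ⟨(LinearEquiv.ofBijective g ⟨?_, hg⟩).symm⟩ hT₀) hX
    rw [← LinearMap.ker_eq_bot, ← hfg, LinearMap.range_eq_bot]
    ext y
    rw [Subsingleton.elim y 0, map_zero, map_zero]
  · intro A Y N f' g' hf' hg' hfg' hN ih X T₀ f g hf hg hfg hT₀ hX
    obtain ⟨W, p, k, l, hp, hfp, hk, hl, hkl, hcomm⟩ :=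
      exists_quotient_extension f' g' hg' hfg' f g hf hg hfg
    have of_mem : W ∈ T → ∃ p : X →ₗ[Λ] M, Surjective p := fun hW =>
      ih X W (f ∘ₗ f') p (hf.comp hf') hp hfp hW hX
    rcases hN with hN | rfl
    · exact of_mem (hT.2.2.2.2 k l hk hl hkl hN hT₀)
    · by_cases hs : ∃ r : W →ₗ[Λ] N, r ∘ₗ k = LinearMap.id
      · obtain ⟨r, hr⟩ := hs
        refine ⟨r ∘ₗ p, Surjective.comp (g := r) (fun n => ⟨k n, ?_⟩) hp⟩
        exact LinearMap.congr_fun hr n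
      · exact of_mem (hM.2.2.2.1 W T₀ k l hk hl hkl hT₀ hs)

lemma IsMinExt.notMem {M : ModuleCat.{0} Λ} (hM : IsMinExt Λ T M) : M ∉ T := fun h => by
  have := hM.2.1
  obtain ⟨x, hx⟩ := exists_ne (0 : M)
  exact hx (LinearMap.congr_fun (hM.2.2.2.2 M h LinearMap.id) x)

lemma mem_filtClosure_union_singleton (M : ModuleCat.{0} Λ) :
    M ∈ filtClosure Λ (T ∪ {M}) :=
  FiltMem.of_mem (Or.inr rfl)

lemma subset_filtClosure_union (C : Set (ModuleCat.{0} Λ)) : T ⊆ filtClosure Λ (T ∪ C) :=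
  fun _ h => FiltMem.of_mem (Or.inl h)

lemma IsMinExt.torsCovers (hT : IsTorsionClass Λ T) {M : ModuleCat.{0} Λ}
    (hM : IsMinExt Λ T M) : TorsCovers Λ (filtClosure Λ (T ∪ {M})) T := by
  refine ⟨isTorsionClass_filtClosure_union_singleton hT hM.1 hM.2.2.1,
    ⟨subset_filtClosure_union _, fun h => hM.notMem (h (mem_filtClosure_union_singleton M))⟩,
    fun C hC hTC hCE => hCE.antisymm ?_⟩
  obtain ⟨X, hXC, hXT⟩ := Set.exists_of_ssubset hTC
  obtain ⟨p, hp⟩ := exists_surjective_of_mem_filtClosure hT hM (hCE hXC) hXT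
  exact filtClosure_subset hC
    (Set.union_subset hTC.subset (Set.singleton_subset_iff.2 (hC.2.2.2.1 p hp hXC)))

lemma IsMinExt.nonempty_equiv [IsNoetherianRing Λ] (hT : IsTorsionClass Λ T)
    {M N : ModuleCat.{0} Λ} (hM : IsMinExt Λ T M) (hN : IsMinExt Λ T N)
    (h : filtClosure Λ (T ∪ {M}) = filtClosure Λ (T ∪ {N})) : Nonempty (M ≃ₗ[Λ] N) := by
  obtain ⟨p, hp⟩ := exists_surjective_of_mem_filtClosure hT hN
    (h ▸ mem_filtClosure_union_singleton M) hM.notMem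
  obtain ⟨q, hq⟩ := exists_surjective_of_mem_filtClosure hT hM
    (h ▸ mem_filtClosure_union_singleton N) hN.notMem
  have := hM.1
  have hinj : Injective (q ∘ₗ p) :=
    IsNoetherian.injective_of_surjective_endomorphism (q ∘ₗ p) (hq.comp hp)
  exact ⟨LinearEquiv.ofBijective p ⟨Injective.of_comp hinj, hp⟩⟩

/-- The members of a torsion class that admit no nonzero map to `M` form a torsion class. -/
lemma isTorsionClass_inter_lPerp {C : Set (ModuleCat.{0} Λ)} (hC : IsTorsionClass Λ C)
    (M : ModuleCat.{0} Λ) : IsTorsionClass Λ {X | X ∈ C ∧ ∀ h : X →ₗ[Λ] M, h = 0} := by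
  have quot : QuotClosed Λ {X | X ∈ C ∧ ∀ h : X →ₗ[Λ] M, h = 0} := by
    refine fun X Y g hg hX => ⟨hC.2.2.2.1 g hg hX.1, fun h => ?_⟩
    ext y
    obtain ⟨x, rfl⟩ := hg y
    exact LinearMap.congr_fun (hX.2 (h ∘ₗ g)) x
  refine ⟨fun X hX => hC.1 X hX.1, fun X Y ⟨e⟩ hX => quot e.toLinearMap e.surjective hX,
    fun X hX => ⟨hC.2.2.1 X hX, fun h => ?_⟩, quot, ?_⟩
  · ext x
    rw [Subsingleton.elim x 0, map_zero, map_zero]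
  · refine fun A X Y f g hf hg hfg hA hY => ⟨hC.2.2.2.2 f g hf hg hfg hA.1 hY.1, fun h => ?_⟩
    obtain ⟨k, hk⟩ := exists_factor_of_ker_le g hg h (by
      rw [← hfg]
      rintro _ ⟨a, rfl⟩
      exact LinearMap.congr_fun (hA.2 (h ∘ₗ f)) a)
    ext x
    rw [← hk, hY.2 k]
    rfl

lemma exists_isMinExt_of_torsCovers [IsArtinianRing Λ] (hT : IsTorsionClass Λ T)
    {T' : Set (ModuleCat.{0} Λ)} (hT' : TorsCovers Λ T' T) :
    ∃ M, IsMinExt Λ T M ∧ filtClosure Λ (T ∪ {M}) = T' := by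
  obtain ⟨htors, hlt, hmin⟩ := hT'
  have hne : (T' \ T).Nonempty := Set.exists_of_ssubset hlt
  let len : ModuleCat.{0} Λ → ℕ∞ := fun M => Module.length Λ M
  obtain ⟨M, ⟨hM', hMT⟩, hMmin⟩ : ∃ M ∈ T' \ T, ∀ N ∈ T' \ T, len M ≤ len N := by
    obtain ⟨M, hM, h⟩ := (wellFounded_lt (α := ℕ∞)).has_min (len '' (T' \ T)) (hne.image _)
    obtain ⟨M, hM, rfl⟩ := hM
    exact ⟨M, hM, fun N hN => not_lt.1 (h _ ⟨N, hN, rfl⟩)⟩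
  have hfg : FG Λ M := htors.1 M hM'
  have hnt : Nontrivial M := by
    by_contra h
    exact hMT (hT.2.2.1 M (not_nontrivial_iff_subsingleton.1 h))
  have hquot : ∀ S : Submodule Λ M, S ≠ ⊥ → ModuleCat.of Λ ((M : Type) ⧸ S) ∈ T := by
    intro S hS
    by_contra h
    exact not_lt.2 (hMmin _ ⟨htors.2.2.2.1 (N := ModuleCat.of Λ (M ⧸ S)) S.mkQ
      S.mkQ_surjective hM', h⟩) (Submodule.length_quotient_lt S hS)
  have htf : ∀ X ∈ T, ∀ f : X →ₗ[Λ] M, f = 0 := by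
    intro X hX f
    by_contra hf
    refine hMT (hT.2.2.2.2 (A := ModuleCat.of Λ (LinearMap.range f)) (M := M)
      (B := ModuleCat.of Λ (M ⧸ LinearMap.range f)) (LinearMap.range f).subtype
      (LinearMap.range f).mkQ Subtype.val_injective (Submodule.mkQ_surjective _) ?_
      (hT.2.2.2.1 f.rangeRestrict f.surjective_rangeRestrict hX)
      (hquot _ fun h => hf (LinearMap.range_eq_bot.1 h)))
    rw [Submodule.ker_mkQ]
    exact Submodule.range_subtype _
  have hsurj : ∀ X ∈ T', ∀ h : X →ₗ[Λ] M, h ≠ 0 → Surjective h := by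
    intro X hX h hh
    by_contra hs
    rw [← LinearMap.range_eq_top] at hs
    refine not_lt.2 (hMmin (ModuleCat.of Λ (LinearMap.range h))
      ⟨htors.2.2.2.1 h.rangeRestrict h.surjective_rangeRestrict hX, fun hR => hh ?_⟩)
      (Submodule.length_lt hs)
    have := htf _ hR (LinearMap.range h).subtype
    ext x
    exact LinearMap.congr_fun this (h.rangeRestrict x)
  have hhom : ∀ X ∈ T', X ∉ T → ∃ h : X →ₗ[Λ] M, h ≠ 0 := by
    intro X hX hXT
    by_contra! hz
    have hss : T ⊂ {X | X ∈ T' ∧ ∀ h : X →ₗ[Λ] M, h = 0} :=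
      ⟨fun Y hY => ⟨hlt.subset hY, htf Y hY⟩, fun h => hXT (h ⟨hX, hz⟩)⟩
    have heq := hmin _ (isTorsionClass_inter_lPerp htors M) hss fun Y hY => hY.1
    rw [← heq] at hM'
    obtain ⟨x, hx⟩ := exists_ne (0 : M)
    exact hx (LinearMap.congr_fun (hM'.2 LinearMap.id) x)
  refine ⟨M, ⟨hfg, hnt, hquot, ?_, htf⟩, ?_⟩
  · intro X T₀ f g hf hg hfg' hT₀ hns
    by_contra hX
    obtain ⟨h, hh⟩ := hhom X (htors.2.2.2.2 f g hf hg hfg' hM' (hlt.subset hT₀)) hX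
    by_cases hz : h ∘ₗ f = 0
    · obtain ⟨k, hk⟩ := exists_factor_of_ker_le g hg h (by
        rw [← hfg']
        rintro _ ⟨a, rfl⟩
        exact LinearMap.congr_fun hz a)
      refine hh ?_
      ext x
      rw [← hk, htf T₀ hT₀ k]
      rfl
    · have hs := hsurj M hM' _ hz
      let e := LinearEquiv.ofBijective (h ∘ₗ f)
        ⟨IsNoetherian.injective_of_surjective_endomorphism _ hs, hs⟩
      refine hns ⟨e.symm.toLinearMap ∘ₗ h, ?_⟩
      ext m
      exact e.symm_apply_apply m
  · exact hmin _ (isTorsionClass_filtClosure_union_singleton hT hfg hquot)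
      ⟨subset_filtClosure_union _, fun h => hMT (h (mem_filtClosure_union_singleton M))⟩
      (filtClosure_subset htors (Set.union_subset hlt.subset (Set.singleton_subset_iff.2 hM')))

end MinimalExtending

/-- For a torsion class `T` in `mod Λ`, the map `M ↦ Filt(T ∪ {M})` is a
bijection from the set of isomorphism classes of minimal extending modules for `T` onto the set
of torsion classes covering `T`. -/
theorem minExt_biject_with_covers_of_torsion_class
    (K Λ : Type) [Field K] [Ring Λ] [Algebra K Λ] [FiniteDimensional K Λ]
    (T : Set (ModuleCat.{0} Λ)) (hT : IsTorsionClass Λ T) :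
    (∀ M, IsMinExt Λ T M → TorsCovers Λ (filtClosure Λ (T ∪ {M})) T) ∧
    (∀ T', TorsCovers Λ T' T → ∃ M, IsMinExt Λ T M ∧ filtClosure Λ (T ∪ {M}) = T') ∧
    (∀ M N, IsMinExt Λ T M → IsMinExt Λ T N →
        filtClosure Λ (T ∪ {M}) = filtClosure Λ (T ∪ {N}) → Nonempty (M ≃ₗ[Λ] N)) := by
  have : IsArtinianRing Λ := IsArtinianRing.of_finite K Λ
  exact ⟨fun M hM => hM.torsCovers hT, fun T' hT' => exists_isMinExt_of_torsCovers hT hT',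
    fun M N hM hN h => hM.nonempty_equiv hT hN h⟩

end BrickPaper
end
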